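/- arXiv:1912.06845 — 2 statements merged into one kernel-verified Lean document; each statement's English description precedes it below -/
import Mathlib

section
/- Let M be an ergodic row-stochastic matrix on a finite state space Ω with generalized contraction coefficient κ̃ and distance-to-stationarity function h. Then for every t ∈ ℕ, h(t) ≤ e · e^{−t(1 − κ̃)}. -/
variable {Ω : Type*} [Fintype Ω] [DecidableEq Ω] [Nonempty Ω]

/-- A probability distribution on `Ω`. -/
def IsDist (f : Ω → ℝ) : Prop := (∀ x, 0 ≤ f x) ∧ ∑ x, f x = 1

/-- A row-stochastic (Markov) matrix. -/
def IsStochastic (M : Matrix Ω Ω ℝ) : Prop :=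
  (∀ i j, 0 ≤ M i j) ∧ ∀ i, ∑ j, M i j = 1

/-- Ergodicity: some power of `M` is entrywise positive. -/
def IsErgodic (M : Matrix Ω Ω ℝ) : Prop := ∃ p : ℕ, 0 < p ∧ ∀ i j, 0 < (M ^ p) i j

/-- Total variation distance between two distributions on `Ω`. -/
noncomputable def tvDist (μ ν : Ω → ℝ) : ℝ := (1 / 2) * ∑ x, |μ x - ν x|

/-- Dobrushin contraction coefficient `κ(M) = max_{i,j} ‖M(i,·) − M(j,·)‖_TV`. -/
noncomputable def dobrushin (M : Matrix Ω Ω ℝ) : ℝ :=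
  Finset.univ.sup' Finset.univ_nonempty fun p : Ω × Ω => tvDist (M p.1) (M p.2)

/-- Generalized contraction coefficient `κ̃ = 1 − sup_{s ≥ 1} (1 − κ(M^s))/s`. -/
noncomputable def genCC (M : Matrix Ω Ω ℝ) : ℝ :=
  1 - ⨆ s : {n : ℕ // 0 < n}, (1 - dobrushin (M ^ (s : ℕ))) / ((s : ℕ) : ℝ)

/-- Distance to stationarity `h(t) = sup_{μ ∈ Δ_Ω} ‖μ M^t − π‖_TV`. -/
noncomputable def distToStat (M : Matrix Ω Ω ℝ) (π : Ω → ℝ) (t : ℕ) : ℝ :=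
  ⨆ μ : {f : Ω → ℝ // IsDist f}, tvDist (Matrix.vecMul μ.1 (M ^ t)) π

/-- Mixing time `t_mix(ξ) = min{t ∈ ℕ : h(t) < ξ}` (with `ℕ = {1,2,…}`). -/
noncomputable def mixTime (M : Matrix Ω Ω ℝ) (π : Ω → ℝ) (ξ : ℝ) : ℕ :=
  sInf {t : ℕ | 0 < t ∧ distToStat M π t < ξ}

open Matrix in
lemma sum_abs_vecMul_le_dobrushin {α : Type*} [Fintype α] [Nonempty α]
    (P : Matrix α α ℝ) (f : α → ℝ) (hf : ∑ x, f x = 0) :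
    ∑ x, |(f ᵥ* P) x| ≤ dobrushin P * ∑ x, |f x| := by
  set ε : α → ℝ := fun x => SignType.sign ((f ᵥ* P) x) with hε
  have abs_ε_le (x : α) : |ε x| ≤ 1 := by
    rcases lt_trichotomy ((f ᵥ* P) x) 0 with h | h | h <;> simp [hε, h]
  set g : α → ℝ := P *ᵥ ε with hg
  have osc (i j : α) : g i - g j ≤ 2 * dobrushin P := by
    have h : tvDist (P i) (P j) ≤ dobrushin P :=
      Finset.le_sup' (fun p : α × α => tvDist (P p.1) (P p.2)) (Finset.mem_univ (i, j))
    calc g i - g j = ∑ x, (P i x - P j x) * ε x := by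
          simp only [hg, mulVec, dotProduct, ← Finset.sum_sub_distrib, sub_mul]
      _ ≤ ∑ x, |P i x - P j x| := by
          refine Finset.sum_le_sum fun x _ => (le_abs_self _).trans ?_
          rw [abs_mul]
          exact mul_le_of_le_one_right (abs_nonneg _) (abs_ε_le x)
      _ ≤ 2 * dobrushin P := by
          unfold tvDist at h
          linarith
  obtain ⟨a, ha⟩ := Finite.exists_max g
  obtain ⟨b, hb⟩ := Finite.exists_min g
  set c : ℝ := (g a + g b) / 2 with hc
  have abs_sub_le (i : α) : |g i - c| ≤ dobrushin P := by
    rw [abs_le]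
    constructor <;> linarith [ha i, hb i, osc a b]
  calc ∑ x, |(f ᵥ* P) x| = (f ᵥ* P) ⬝ᵥ ε := by
        simp only [dotProduct, hε, self_mul_sign]
    _ = ∑ i, f i * g i := by rw [← dotProduct_mulVec]; rfl
    _ = ∑ i, f i * (g i - c) := by
        simp only [mul_sub, Finset.sum_sub_distrib, ← Finset.sum_mul, hf, zero_mul, sub_zero]
    _ ≤ ∑ i, dobrushin P * |f i| := by
        refine Finset.sum_le_sum fun i _ => (le_abs_self _).trans ?_
        rw [abs_mul, mul_comm]
        exact mul_le_mul_of_nonneg_right (abs_sub_le i) (abs_nonneg _)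
    _ = dobrushin P * ∑ x, |f x| := by rw [Finset.mul_sum]

lemma dobrushin_nonneg {α : Type*} [Fintype α] [Nonempty α]
    (P : Matrix α α ℝ) : 0 ≤ dobrushin P := by
  obtain ⟨i⟩ := ‹Nonempty α›
  refine le_trans ?_ (Finset.le_sup' (fun p : α × α => tvDist (P p.1) (P p.2))
    (Finset.mem_univ (i, i)))
  simp [tvDist]

lemma IsStochastic.sum_vecMul {α : Type*} [Fintype α]
    {P : Matrix α α ℝ} (hP : IsStochastic P) (f : α → ℝ) :
    ∑ x, Matrix.vecMul f P x = ∑ x, f x := by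
  simp only [Matrix.vecMul, dotProduct]
  rw [Finset.sum_comm]
  simp [← Finset.mul_sum, hP.2]

lemma IsStochastic.isDist_vecMul {α : Type*} [Fintype α]
    {P : Matrix α α ℝ} (hP : IsStochastic P) {f : α → ℝ}
    (hf : IsDist f) : IsDist (Matrix.vecMul f P) :=
  ⟨fun x => Finset.sum_nonneg fun i _ => mul_nonneg (hf.1 i) (hP.1 i x),
    (hP.sum_vecMul f).trans hf.2⟩

lemma IsStochastic.pow {α : Type*} [Fintype α] [DecidableEq α]
    {M : Matrix α α ℝ} (hM : IsStochastic M) (n : ℕ) :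
    IsStochastic (M ^ n) := by
  induction n with
  | zero =>
    refine ⟨fun i j => ?_, fun i => by simp [Matrix.one_apply]⟩
    rw [pow_zero, Matrix.one_apply]
    split_ifs <;> norm_num
  | succ n ih =>
    have row (i : α) : (M ^ (n + 1)) i = Matrix.vecMul ((M ^ n) i) M := by
      rw [pow_succ]; rfl
    have h (i : α) := hM.isDist_vecMul (f := (M ^ n) i) ⟨ih.1 i, ih.2 i⟩
    exact ⟨fun i => row i ▸ (h i).1, fun i => row i ▸ (h i).2⟩

lemma tvDist_le_one {α : Type*} [Fintype α]
    {μ ν : α → ℝ} (hμ : IsDist μ) (hν : IsDist ν) : tvDist μ ν ≤ 1 := by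
  have h : ∑ x, |μ x - ν x| ≤ ∑ x, (μ x + ν x) := by
    refine Finset.sum_le_sum fun x _ => ?_
    rw [abs_le]
    constructor <;> linarith [hμ.1 x, hν.1 x]
  rw [Finset.sum_add_distrib, hμ.2, hν.2] at h
  unfold tvDist
  linarith

lemma tvDist_vecMul_le {α : Type*} [Fintype α] [Nonempty α]
    {P : Matrix α α ℝ} {μ ν : α → ℝ}
    (hμ : IsDist μ) (hν : IsDist ν) :
    tvDist (Matrix.vecMul μ P) (Matrix.vecMul ν P) ≤ dobrushin P * tvDist μ ν := by
  have h := sum_abs_vecMul_le_dobrushin P (μ - ν) (by simp [hμ.2, hν.2])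
  simp only [Matrix.sub_vecMul, Pi.sub_apply] at h
  unfold tvDist
  linarith

lemma IsStochastic.tvDist_vecMul_pow_le {P : Matrix Ω Ω ℝ} (hP : IsStochastic P) {μ ν : Ω → ℝ}
    (hμ : IsDist μ) (hν : IsDist ν) (n : ℕ) :
    tvDist (Matrix.vecMul μ (P ^ n)) (Matrix.vecMul ν (P ^ n)) ≤ dobrushin P ^ n := by
  induction n with
  | zero => simpa using tvDist_le_one hμ hν
  | succ n ih =>
    have h := tvDist_vecMul_le (P := P) ((hP.pow n).isDist_vecMul hμ) ((hP.pow n).isDist_vecMul hν)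
    rw [Matrix.vecMul_vecMul, Matrix.vecMul_vecMul, ← pow_succ] at h
    rw [pow_succ' (dobrushin P)]
    exact h.trans (mul_le_mul_of_nonneg_left ih (dobrushin_nonneg P))

lemma vecMul_pow_eq_self {α : Type*} [Fintype α] [DecidableEq α]
    {M : Matrix α α ℝ} {π : α → ℝ} (hstat : Matrix.vecMul π M = π) (n : ℕ) :
    Matrix.vecMul π (M ^ n) = π := by
  induction n with
  | zero => simp
  | succ n ih => rw [pow_succ, ← Matrix.vecMul_vecMul, ih, hstat]

lemma distToStat_le_dobrushin_pow {M : Matrix Ω Ω ℝ} (hM : IsStochastic M) {π : Ω → ℝ}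
    (hπ : IsDist π) (hstat : Matrix.vecMul π M = π) (s t : ℕ) :
    distToStat M π t ≤ dobrushin (M ^ s) ^ (t / s) := by
  have : Nonempty {f : Ω → ℝ // IsDist f} := ⟨⟨π, hπ⟩⟩
  refine ciSup_le fun μ => ?_
  have h := (hM.pow s).tvDist_vecMul_pow_le ((hM.pow (t % s)).isDist_vecMul μ.2) hπ (t / s)
  rwa [← pow_mul, vecMul_pow_eq_self hstat, Matrix.vecMul_vecMul, ← pow_add, Nat.mod_add_div] at h

lemma pow_div_le_exp {k : ℝ} (hk : 0 ≤ k) (hk1 : k ≤ 1) {s : ℕ} (hs : 0 < s) (t : ℕ) :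
    k ^ (t / s) ≤ Real.exp (1 - t * ((1 - k) / s)) := by
  have hs' : (0 : ℝ) < s := by exact_mod_cast hs
  have hq : (t : ℝ) / s ≤ (t / s : ℕ) + 1 := by
    rw [div_le_iff₀ hs']
    exact_mod_cast (Nat.lt_mul_of_div_lt (Nat.lt_succ_self (t / s)) hs).le
  calc k ^ (t / s) ≤ Real.exp (-(1 - k)) ^ (t / s) := by
        refine pow_le_pow_left₀ hk ?_ _
        linarith [Real.add_one_le_exp (-(1 - k))]
    _ = Real.exp ((t / s : ℕ) * -(1 - k)) := (Real.exp_nat_mul _ _).symm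
    _ ≤ Real.exp (1 - t * ((1 - k) / s)) := by
        rw [Real.exp_le_exp, mul_div_assoc', mul_comm (t : ℝ), mul_div_assoc]
        nlinarith [mul_le_mul_of_nonneg_left hq (sub_nonneg.2 hk1)]

lemma IsStochastic.dobrushin_le_one {α : Type*} [Fintype α] [Nonempty α]
    {P : Matrix α α ℝ} (hP : IsStochastic P) :
    dobrushin P ≤ 1 :=
  Finset.sup'_le _ _ fun p _ => tvDist_le_one ⟨hP.1 p.1, hP.2 p.1⟩ ⟨hP.1 p.2, hP.2 p.2⟩

/-- `h(t) ≤ e · e^{−t(1 − κ̃)}` for every `t ∈ ℕ`. -/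
theorem distToStat_le_exp (M : Matrix Ω Ω ℝ) (hM : IsStochastic M)
    (hErg : IsErgodic M) (π : Ω → ℝ) (hπ : IsDist π)
    (hstat : Matrix.vecMul π M = π) :
    ∀ t : ℕ, distToStat M π t ≤ Real.exp 1 * Real.exp (-(t : ℝ) * (1 - genCC M)) := by
  intro t
  have key (s : {n : ℕ // 0 < n}) : distToStat M π t ≤
      Real.exp (1 - t * ((1 - dobrushin (M ^ (s : ℕ))) / ((s : ℕ) : ℝ))) :=
    (distToStat_le_dobrushin_pow hM hπ hstat s t).trans
      (pow_div_le_exp (dobrushin_nonneg _) (hM.pow s).dobrushin_le_one s.2 t)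
  rw [← Real.exp_add, genCC, sub_sub_cancel]
  rcases le_or_gt (distToStat M π t) 0 with h0 | h0
  · exact h0.trans (Real.exp_pos _).le
  rw [← Real.log_le_iff_le_exp h0]
  rcases Nat.eq_zero_or_pos t with rfl | ht
  · simpa [Real.log_le_iff_le_exp h0] using key ⟨1, one_pos⟩
  have ht' : (0 : ℝ) < t := by exact_mod_cast ht
  have : Nonempty {n : ℕ // 0 < n} := ⟨⟨1, one_pos⟩⟩
  have hsup : ⨆ s : {n : ℕ // 0 < n}, (1 - dobrushin (M ^ (s : ℕ))) / ((s : ℕ) : ℝ) ≤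
      (1 - Real.log (distToStat M π t)) / t := by
    refine ciSup_le fun s => ?_
    rw [le_div_iff₀' ht']
    linarith [(Real.log_le_iff_le_exp h0).2 (key s)]
  rw [le_div_iff₀' ht'] at hsup
  linarith
end

section
/- There exist universal constants c, c' > 0 with the following property. Let ε, δ ∈ (0,1) and d ∈ ℕ. There exists an estimator (a function of the observed trajectory) κ̂ : Ω^m → (0,1) such that for every ergodic Markov chain X₁, …, X_m ~ (μ, M) on Ω with |Ω| = d, minimum stationary probability π_min and generalized contraction coefficient κ̃, whenever m ≥ c (𝓛/π_min) max{1/(1 − κ̃), d/ε²} with 𝓛 = c' · ln(d/(δ ε π_min)) · ln ln(d/(δ ε π_min)), the bound |κ̂(X₁,…,X_m) − κ̃| < ε holds with probability at least 1 − δ. -/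
variable {Ω : Type*} [Fintype Ω] [DecidableEq Ω] [Nonempty Ω]

/-- Probability of observing the trajectory `x = (X₁, …, X_m)` for the Markov chain
with initial distribution `μ` and transition matrix `M`. -/
noncomputable def pathProb (μ : Ω → ℝ) (M : Matrix Ω Ω ℝ) {m : ℕ} (x : Fin m → Ω) : ℝ :=
  if h : m = 0 then 1
  else
    μ (x ⟨0, Nat.pos_of_ne_zero h⟩) *
      ∏ t : Fin (m - 1),
        M (x ⟨t.1, by have := t.2; omega⟩) (x ⟨t.1 + 1, by have := t.2; omega⟩)

/-- Probability of an event `E` under the law of the trajectory `(X₁, …, X_m) ∼ (μ, M)`. -/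
noncomputable def prTraj (μ : Ω → ℝ) (M : Matrix Ω Ω ℝ) (m : ℕ)
    (E : Set (Fin m → Ω)) : ℝ :=
  ∑ x : Fin m → Ω, E.indicator (pathProb μ M) x

/-- `N_i^{(s)}`: number of visits to state `i` by the `s`-skipped chain, i.e. the number of
`t ∈ {1, …, ⌊(m−1)/s⌋}` such that `X_{1+s(t−1)} = i`. -/
def Nvisit (s : ℕ) {m : ℕ} (x : Fin m → Ω) (i : Ω) : ℕ :=
  ∑ t : Fin ((m - 1) / s),
    if h : s * t.1 < m then (if x ⟨s * t.1, h⟩ = i then 1 else 0) else 0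

/-- `N_min^{(s)}`: the least number of visits of the `s`-skipped chain. -/
def Nmin (s : ℕ) {m : ℕ} (x : Fin m → Ω) : ℕ :=
  Finset.univ.inf' Finset.univ_nonempty (Nvisit s x)

/-- `N_{ij}^{(s)}`: number of observed transitions `i → j` of the `s`-skipped chain. -/
def Npair (s : ℕ) {m : ℕ} (x : Fin m → Ω) (i j : Ω) : ℕ :=
  ∑ t : Fin ((m - 1) / s),
    if h : s * t.1 + s < m then
      (if x ⟨s * t.1, Nat.lt_of_le_of_lt (Nat.le_add_right _ _) h⟩ = i ∧
          x ⟨s * t.1 + s, h⟩ = j then 1 else 0)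
    else 0

/-- Empirical `s`-step transition matrix `M̂^{(s)}`. -/
noncomputable def empMat (s : ℕ) {m : ℕ} (x : Fin m → Ω) : Matrix Ω Ω ℝ :=
  Matrix.of fun i j =>
    if 0 < Nvisit s x i then (Npair s x i j : ℝ) / (Nvisit s x i : ℝ) else 0

/-- Minimum stationary probability `π_min`. -/
noncomputable def piMinOf (π : Ω → ℝ) : ℝ :=
  Finset.univ.inf' Finset.univ_nonempty π

set_option linter.unusedSectionVars false

lemma sum_path_weight_eq (n : ℕ) (W : Matrix Ω Ω ℝ) (μ φ : Ω → ℝ) :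
    ∑ x : Fin (n + 1) → Ω,
      μ (x 0) * (∏ t : Fin n, W (x t.castSucc) (x t.succ)) * φ (x (Fin.last n)) =
    ∑ a, μ a * (W ^ n).mulVec φ a := by
  induction n generalizing μ with
  | zero =>
    rw [← (Equiv.funUnique (Fin 1) Ω).symm.sum_comp]
    simp
  | succ n ih =>
    rw [← (Fin.consEquiv (fun _ => Ω)).sum_comp, Fintype.sum_prod_type, Finset.sum_comm]
    have h := ih (fun b => ∑ a, μ a * W a b)
    have e : ∀ y : Fin (n + 1) → Ω, (∑ a : Ω, μ (Fin.consEquiv (fun _ => Ω) (a, y) 0) *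
        (∏ t : Fin (n + 1), W (Fin.consEquiv (fun _ => Ω) (a, y) t.castSucc)
          (Fin.consEquiv (fun _ => Ω) (a, y) t.succ)) *
          φ (Fin.consEquiv (fun _ => Ω) (a, y) (Fin.last (n + 1)))) =
        (∑ a, μ a * W a (y 0)) * (∏ t : Fin n, W (y t.castSucc) (y t.succ)) *
          φ (y (Fin.last n)) := by
      intro y
      rw [Finset.sum_mul, Finset.sum_mul]
      refine Finset.sum_congr rfl fun a _ => ?_
      rw [Fin.prod_univ_succ, ← Fin.succ_last]
      simp only [Fin.consEquiv_apply, Fin.cons_zero, Fin.cons_succ, Fin.castSucc_zero,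
        ← Fin.succ_castSucc]
      ring
    rw [Finset.sum_congr rfl fun y _ => e y, h, pow_succ', ← Matrix.mulVec_mulVec]
    generalize (W ^ n).mulVec φ = v
    simp only [Matrix.mulVec, dotProduct, Finset.sum_mul, Finset.mul_sum]
    rw [Finset.sum_comm]
    exact Finset.sum_congr rfl fun a _ => Finset.sum_congr rfl fun b _ => by ring

lemma pathProb_succ (μ : Ω → ℝ) (M : Matrix Ω Ω ℝ) {n : ℕ} (x : Fin (n + 1) → Ω) :
    pathProb μ M x = μ (x 0) * ∏ t : Fin n, M (x t.castSucc) (x t.succ) := by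
  simp only [pathProb, Nat.add_eq_zero_iff, one_ne_zero, and_false, dite_false]
  rfl

lemma pathProb_nonneg {μ : Ω → ℝ} {M : Matrix Ω Ω ℝ} (hμ : IsDist μ) (hM : IsStochastic M)
    {m : ℕ} (x : Fin m → Ω) : 0 ≤ pathProb μ M x := by
  unfold pathProb
  split_ifs
  · exact zero_le_one
  · exact mul_nonneg (hμ.1 _) (Finset.prod_nonneg fun t _ => hM.1 _ _)

lemma IsStochastic.mulVec_one {M : Matrix Ω Ω ℝ} (hM : IsStochastic M) :
    M.mulVec (fun _ => 1) = fun _ => 1 := by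
  funext i
  simpa [Matrix.mulVec, dotProduct] using hM.2 i

lemma IsStochastic.mul {A B : Matrix Ω Ω ℝ} (hA : IsStochastic A) (hB : IsStochastic B) :
    IsStochastic (A * B) := by
  refine ⟨fun i j => Finset.sum_nonneg fun k _ => mul_nonneg (hA.1 _ _) (hB.1 _ _),
    fun i => ?_⟩
  simp only [Matrix.mul_apply]
  rw [Finset.sum_comm]
  simp only [← Finset.mul_sum, hB.2, mul_one, hA.2]

lemma IsStochastic.one : IsStochastic (1 : Matrix Ω Ω ℝ) := by
  refine ⟨fun i j => ?_, fun i => ?_⟩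
  · rw [Matrix.one_apply]; split_ifs <;> norm_num
  · simp [Matrix.one_apply]

lemma IsStochastic.pow_s14 {M : Matrix Ω Ω ℝ} (hM : IsStochastic M) (t : ℕ) :
    IsStochastic (M ^ t) := by
  induction t with
  | zero => simpa using IsStochastic.one
  | succ t ih => rw [pow_succ]; exact ih.mul hM

lemma sum_pathProb {μ : Ω → ℝ} {M : Matrix Ω Ω ℝ} (hμ : IsDist μ) (hM : IsStochastic M)
    (m : ℕ) : ∑ x : Fin m → Ω, pathProb μ M x = 1 := by
  cases m with
  | zero => simp [pathProb]
  | succ n =>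
    have h := sum_path_weight_eq n M μ (fun _ => 1)
    rw [(hM.pow_s14 n).mulVec_one] at h
    simpa only [pathProb_succ, mul_one, hμ.2] using h

lemma pow_mulVec_le {W : Matrix Ω Ω ℝ} {φ : Ω → ℝ} (hW : ∀ i j, 0 ≤ W i j)
    (h : ∀ i, W.mulVec φ i ≤ φ i) (n : ℕ) (i : Ω) : (W ^ n).mulVec φ i ≤ φ i := by
  induction n generalizing i with
  | zero => simp
  | succ n ih =>
    rw [pow_succ', ← Matrix.mulVec_mulVec]
    refine le_trans (Finset.sum_le_sum fun j _ => ?_) (h i)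
    exact mul_le_mul_of_nonneg_left (ih j) (hW i j)

/-- Chernoff bound for an additive functional of a chain whose exponential, corrected by a
potential `φ` with values in `[l, C]`, is a supermartingale. -/
lemma prTraj_le_exp {μ : Ω → ℝ} {M : Matrix Ω Ω ℝ} (hμ : IsDist μ) (hM : IsStochastic M)
    (w : Ω → Ω → ℝ) (φ : Ω → ℝ) {l C : ℝ} (hl : 0 < l) (hlφ : ∀ i, l ≤ φ i)
    (hφC : ∀ i, φ i ≤ C)
    (hφ : ∀ i, ∑ j, M i j * Real.exp (w i j) * φ j ≤ φ i) {n : ℕ} {r : ℝ}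
    {S : Set (Fin (n + 1) → Ω)}
    (hS : ∀ x ∈ S, r ≤ ∑ t : Fin n, w (x t.castSucc) (x t.succ)) :
    prTraj μ M (n + 1) S ≤ C / l * Real.exp (-r) := by
  set W : Matrix Ω Ω ℝ := Matrix.of fun i j => M i j * Real.exp (w i j) with hWdef
  have hW : ∀ i j, 0 ≤ W i j := fun i j => mul_nonneg (hM.1 i j) (Real.exp_pos _).le
  have key : ∑ a, μ a * (W ^ n).mulVec φ a ≤ C := by
    calc _ ≤ ∑ a, μ a * C := Finset.sum_le_sum fun a _ => mul_le_mul_of_nonneg_left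
          ((pow_mulVec_le hW hφ n a).trans (hφC a)) (hμ.1 a)
      _ = C := by rw [← Finset.sum_mul, hμ.2, one_mul]
  rw [← sum_path_weight_eq] at key
  have hc : 0 < l * Real.exp r := by positivity
  have : prTraj μ M (n + 1) S * (l * Real.exp r) ≤ C := by
    refine le_trans ?_ key
    rw [prTraj, Finset.sum_mul]
    refine Finset.sum_le_sum fun x _ => ?_
    have hprod : μ (x 0) * (∏ t : Fin n, W (x t.castSucc) (x t.succ)) =
        pathProb μ M x * Real.exp (∑ t : Fin n, w (x t.castSucc) (x t.succ)) := by
      simp only [hWdef, Matrix.of_apply, Finset.prod_mul_distrib, ← Real.exp_sum, pathProb_succ]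
      ring
    rw [hprod]
    have hp := pathProb_nonneg hμ hM x
    by_cases hx : x ∈ S
    · rw [Set.indicator_of_mem hx, mul_assoc]
      refine mul_le_mul_of_nonneg_left ?_ hp
      rw [mul_comm]
      exact mul_le_mul (Real.exp_le_exp.2 (hS x hx)) (hlφ _) hl.le (Real.exp_pos _).le
    · rw [Set.indicator_of_notMem hx, zero_mul]
      exact mul_nonneg (mul_nonneg hp (Real.exp_pos _).le) (hl.le.trans (hlφ _))
  rw [← le_div_iff₀ hc] at this
  rwa [Real.exp_neg, ← div_eq_mul_inv, div_div]

lemma one_le_prTraj_add_sum {μ : Ω → ℝ} {M : Matrix Ω Ω ℝ} (hμ : IsDist μ)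
    (hM : IsStochastic M) {m : ℕ} {ι : Type*} [Fintype ι] (E : Set (Fin m → Ω))
    (B : ι → Set (Fin m → Ω)) (h : ∀ x, x ∉ E → ∃ k, x ∈ B k) :
    1 ≤ prTraj μ M m E + ∑ k, prTraj μ M m (B k) := by
  unfold prTraj
  rw [← sum_pathProb hμ hM m, Finset.sum_comm, ← Finset.sum_add_distrib]
  refine Finset.sum_le_sum fun x _ => ?_
  have hp := pathProb_nonneg hμ hM x
  have hB : ∀ k, 0 ≤ (B k).indicator (pathProb μ M) x := fun k =>
    Set.indicator_nonneg (fun y _ => pathProb_nonneg hμ hM y) x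
  by_cases hx : x ∈ E
  · rw [Set.indicator_of_mem hx]
    exact le_add_of_nonneg_right (Finset.sum_nonneg fun k _ => hB k)
  · obtain ⟨k, hk⟩ := h x hx
    rw [Set.indicator_of_notMem hx, zero_add]
    refine le_trans ?_ (Finset.single_le_sum (fun k _ => hB k) (Finset.mem_univ k))
    rw [Set.indicator_of_mem hk]

lemma tvDist_nonneg (μ ν : Ω → ℝ) : 0 ≤ tvDist μ ν :=
  mul_nonneg (by norm_num) (Finset.sum_nonneg fun _ _ => abs_nonneg _)

lemma tvDist_le_dobrushin (M : Matrix Ω Ω ℝ) (i j : Ω) : tvDist (M i) (M j) ≤ dobrushin M :=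
  Finset.le_sup' (fun p : Ω × Ω => tvDist (M p.1) (M p.2)) (Finset.mem_univ (i, j))

lemma dobrushin_nonneg_s14 (M : Matrix Ω Ω ℝ) : 0 ≤ dobrushin M :=
  (tvDist_nonneg _ _).trans (tvDist_le_dobrushin M (Classical.arbitrary Ω) (Classical.arbitrary Ω))

lemma contraction_rate_le_one (M : Matrix Ω Ω ℝ) (s : {n : ℕ // 0 < n}) :
    (1 - dobrushin (M ^ (s : ℕ))) / ((s : ℕ) : ℝ) ≤ 1 := by
  have hs : (1 : ℝ) ≤ (s : ℕ) := by exact_mod_cast s.2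
  rw [div_le_one (by linarith)]
  linarith [dobrushin_nonneg_s14 (M ^ (s : ℕ))]

lemma bddAbove_contraction_rate (M : Matrix Ω Ω ℝ) :
    BddAbove (Set.range fun s : {n : ℕ // 0 < n} =>
      (1 - dobrushin (M ^ (s : ℕ))) / ((s : ℕ) : ℝ)) :=
  ⟨1, by rintro _ ⟨s, rfl⟩; exact contraction_rate_le_one M s⟩

lemma genCC_nonneg (M : Matrix Ω Ω ℝ) : 0 ≤ genCC M := by
  have : Nonempty {n : ℕ // 0 < n} := ⟨⟨1, one_pos⟩⟩
  exact sub_nonneg.2 (ciSup_le (contraction_rate_le_one M))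

lemma genCC_lt_one {M : Matrix Ω Ω ℝ} (hM : IsStochastic M) (he : IsErgodic M) :
    genCC M < 1 := by
  obtain ⟨p, hp, hpos⟩ := he
  have hd : dobrushin (M ^ p) < 1 := by
    refine (Finset.sup'_lt_iff _).2 fun q _ => ?_
    have : ∑ x, |(M ^ p) q.1 x - (M ^ p) q.2 x| < ∑ x, ((M ^ p) q.1 x + (M ^ p) q.2 x) := by
      refine Finset.sum_lt_sum_of_nonempty Finset.univ_nonempty fun x _ => ?_
      rw [abs_lt]
      constructor <;> linarith [hpos q.1 x, hpos q.2 x]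
    rw [Finset.sum_add_distrib, (hM.pow_s14 p).2, (hM.pow_s14 p).2] at this
    unfold tvDist
    linarith
  have hp' : (0 : ℝ) < p := by exact_mod_cast hp
  have := le_ciSup (bddAbove_contraction_rate M) ⟨p, hp⟩
  have h2 : 0 < (1 - dobrushin (M ^ p)) / (p : ℝ) := div_pos (by linarith) hp'
  unfold genCC
  dsimp only at this
  linarith

lemma sum_abs_pow_sub_le {A B : Matrix Ω Ω ℝ} (hA : IsStochastic A) (hB : IsStochastic B)
    {w : ℝ} (h : ∀ i, ∑ j, |A i j - B i j| ≤ w) (s : ℕ) (i : Ω) :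
    ∑ j, |(A ^ s) i j - (B ^ s) i j| ≤ s * w := by
  induction s generalizing i with
  | zero => simp
  | succ s ih =>
    have e : ∀ j, |(A ^ (s + 1)) i j - (B ^ (s + 1)) i j| ≤
        ∑ k, ((A ^ s) i k * |A k j - B k j| + |(A ^ s) i k - (B ^ s) i k| * B k j) := by
      intro j
      rw [pow_succ, pow_succ, Matrix.mul_apply, Matrix.mul_apply, ← Finset.sum_sub_distrib]
      refine (Finset.abs_sum_le_sum_abs _ _).trans (Finset.sum_le_sum fun k _ => ?_)
      have : (A ^ s) i k * A k j - (B ^ s) i k * B k j =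
        (A ^ s) i k * (A k j - B k j) + ((A ^ s) i k - (B ^ s) i k) * B k j := by ring
      rw [this]
      refine (abs_add_le _ _).trans ?_
      rw [abs_mul, abs_mul, abs_of_nonneg ((hA.pow_s14 s).1 i k), abs_of_nonneg (hB.1 k j)]
    refine (Finset.sum_le_sum fun j _ => e j).trans ?_
    rw [Finset.sum_comm]
    simp only [Finset.sum_add_distrib, ← Finset.mul_sum, hB.2, mul_one]
    have h1 : ∑ k, (A ^ s) i k * ∑ j, |A k j - B k j| ≤ w := by
      calc _ ≤ ∑ k, (A ^ s) i k * w := Finset.sum_le_sum fun k _ =>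
            mul_le_mul_of_nonneg_left (h k) ((hA.pow_s14 s).1 i k)
        _ = w := by rw [← Finset.sum_mul, (hA.pow_s14 s).2, one_mul]
    push_cast
    linarith [ih i]

lemma dobrushin_le_add {A B : Matrix Ω Ω ℝ} {w : ℝ} (h : ∀ i, ∑ j, |A i j - B i j| ≤ w) :
    dobrushin A ≤ dobrushin B + w := by
  refine Finset.sup'_le _ _ fun p _ => ?_
  have hB := tvDist_le_dobrushin B p.1 p.2
  have : ∑ x, |A p.1 x - A p.2 x| ≤ ∑ x, (|A p.1 x - B p.1 x| + |A p.2 x - B p.2 x| +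
      |B p.1 x - B p.2 x|) := by
    refine Finset.sum_le_sum fun x _ => ?_
    have e : A p.1 x - A p.2 x = (A p.1 x - B p.1 x) - (A p.2 x - B p.2 x) +
      (B p.1 x - B p.2 x) := by ring
    rw [e]
    exact (abs_add_le _ _).trans (add_le_add (abs_sub _ _) le_rfl)
  simp only [Finset.sum_add_distrib] at this
  unfold tvDist at hB ⊢
  linarith [h p.1, h p.2]

/-- The generalized contraction coefficient is `1`-Lipschitz in the row-wise `ℓ¹` distance. -/
lemma genCC_le_add {A B : Matrix Ω Ω ℝ} (hA : IsStochastic A) (hB : IsStochastic B)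
    {w : ℝ} (h : ∀ i, ∑ j, |A i j - B i j| ≤ w) : genCC A ≤ genCC B + w := by
  have : Nonempty {n : ℕ // 0 < n} := ⟨⟨1, one_pos⟩⟩
  have : ⨆ s : {n : ℕ // 0 < n}, (1 - dobrushin (B ^ (s : ℕ))) / ((s : ℕ) : ℝ) ≤
      (⨆ s : {n : ℕ // 0 < n}, (1 - dobrushin (A ^ (s : ℕ))) / ((s : ℕ) : ℝ)) + w := by
    refine ciSup_le fun s => ?_
    have hs : (0 : ℝ) < (s : ℕ) := by exact_mod_cast s.2
    have h1 := le_ciSup (bddAbove_contraction_rate A) s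
    have h2 := dobrushin_le_add (sum_abs_pow_sub_le hA hB h s)
    have h3 : (1 - dobrushin (B ^ (s : ℕ))) / ((s : ℕ) : ℝ) ≤
        (1 - dobrushin (A ^ (s : ℕ))) / ((s : ℕ) : ℝ) + w := by
      rw [div_add' _ _ _ hs.ne']
      gcongr
      linarith
    linarith
  unfold genCC
  linarith

lemma abs_genCC_sub_le {A B : Matrix Ω Ω ℝ} (hA : IsStochastic A) (hB : IsStochastic B)
    {w : ℝ} (h : ∀ i, ∑ j, |A i j - B i j| ≤ w) : |genCC A - genCC B| ≤ w := by
  have h1 := genCC_le_add hA hB h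
  have h2 := genCC_le_add hB hA (w := w) (fun i => by simpa only [abs_sub_comm] using h i)
  rw [abs_le]
  constructor <;> linarith

lemma genCC_of_subsingleton [Subsingleton Ω] (M : Matrix Ω Ω ℝ) : genCC M = 0 := by
  have : Nonempty {n : ℕ // 0 < n} := ⟨⟨1, one_pos⟩⟩
  have hd : ∀ A : Matrix Ω Ω ℝ, dobrushin A = 0 := fun A => by
    refine le_antisymm (Finset.sup'_le _ _ fun p _ => ?_) (dobrushin_nonneg_s14 A)
    rw [Subsingleton.elim p.1 p.2]
    simp [tvDist]
  refine le_antisymm ?_ (genCC_nonneg M)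
  have := le_ciSup (bddAbove_contraction_rate M) ⟨1, one_pos⟩
  simp only [hd] at this
  simp only [genCC, hd]
  norm_num at this ⊢
  exact this

lemma dobrushin_mulVec_sub_le {B : Matrix Ω Ω ℝ} (hB : IsStochastic B) {f : Ω → ℝ} {w : ℝ}
    (h : ∀ x y, f x - f y ≤ w) (x y : Ω) :
    B.mulVec f x - B.mulVec f y ≤ dobrushin B * w := by
  obtain ⟨a, ha⟩ := Finite.exists_max f
  obtain ⟨b, hb⟩ := Finite.exists_min f
  set c := (f a + f b) / 2 with hc
  have hab := h a b
  have hf : ∀ z, |f z - c| ≤ w / 2 := fun z => by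
    rw [abs_le]; constructor <;> linarith [ha z, hb z]
  have hw : 0 ≤ w / 2 := (abs_nonneg _).trans (hf a)
  have e : B.mulVec f x - B.mulVec f y = ∑ z, (B x z - B y z) * (f z - c) := by
    simp only [Matrix.mulVec, dotProduct, sub_mul, mul_sub, Finset.sum_sub_distrib,
      ← Finset.sum_mul, hB.2]
    ring
  rw [e]
  calc _ ≤ ∑ z, |B x z - B y z| * (w / 2) := Finset.sum_le_sum fun z _ => by
        refine (le_abs_self _).trans ?_
        rw [abs_mul]
        exact mul_le_mul_of_nonneg_left (hf z) (abs_nonneg _)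
    _ = tvDist (B x) (B y) * w := by rw [← Finset.sum_mul, tvDist]; ring
    _ ≤ _ := mul_le_mul_of_nonneg_right (tvDist_le_dobrushin B x y) (by linarith)

lemma pow_mulVec_sub_le {M : Matrix Ω Ω ℝ} (hM : IsStochastic M) (s k r : ℕ) {f : Ω → ℝ}
    (hf : ∀ x, 0 ≤ f x ∧ f x ≤ 1) (x y : Ω) :
    (M ^ (k * s + r)).mulVec f x - (M ^ (k * s + r)).mulVec f y ≤ dobrushin (M ^ s) ^ k := by
  induction k generalizing x y with
  | zero =>
    have h0 : 0 ≤ (M ^ r).mulVec f y :=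
      Finset.sum_nonneg fun z _ => mul_nonneg ((hM.pow_s14 r).1 y z) (hf z).1
    have h1 : (M ^ r).mulVec f x ≤ ∑ z, (M ^ r) x z := Finset.sum_le_sum fun z _ =>
      mul_le_of_le_one_right ((hM.pow_s14 r).1 x z) (hf z).2
    rw [(hM.pow_s14 r).2] at h1
    simp only [zero_mul, zero_add, pow_zero]
    linarith
  | succ k ih =>
    have e : (k + 1) * s + r = s + (k * s + r) := by ring
    rw [e, pow_add, ← Matrix.mulVec_mulVec, pow_succ' (dobrushin (M ^ s))]
    exact dobrushin_mulVec_sub_le (hM.pow_s14 s) ih x y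

lemma vecMul_pow_of_stationary {M : Matrix Ω Ω ℝ} {π : Ω → ℝ} (h : Matrix.vecMul π M = π) (t : ℕ) :
    Matrix.vecMul π (M ^ t) = π := by
  induction t with
  | zero => simp
  | succ t ih => rw [pow_succ, ← Matrix.vecMul_vecMul, ih, h]

lemma abs_pow_mulVec_sub_le {M : Matrix Ω Ω ℝ} (hM : IsStochastic M) {π : Ω → ℝ}
    (hπ : IsDist π) (h : Matrix.vecMul π M = π) (s k r : ℕ) (i x : Ω) :
    |(M ^ (k * s + r)) x i - π i| ≤ dobrushin (M ^ s) ^ k := by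
  have key := pow_mulVec_sub_le hM s k r (f := Pi.single i 1) (fun z => by
    rw [Pi.single_apply]; split_ifs <;> norm_num)
  simp only [Matrix.mulVec_single_one, Matrix.col_apply] at key
  have hst : π i = ∑ y, π y * (M ^ (k * s + r)) y i := by
    conv_lhs => rw [← vecMul_pow_of_stationary h (k * s + r)]
    rfl
  have e : (M ^ (k * s + r)) x i - π i =
      ∑ y, π y * ((M ^ (k * s + r)) x i - (M ^ (k * s + r)) y i) := by
    simp only [mul_sub, Finset.sum_sub_distrib, ← Finset.sum_mul, hπ.2, one_mul, ← hst]
  rw [e]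
  refine (Finset.abs_sum_le_sum_abs _ _).trans ?_
  calc _ ≤ ∑ y, π y * dobrushin (M ^ s) ^ k := Finset.sum_le_sum fun y _ => by
        rw [abs_mul, abs_of_nonneg (hπ.1 y)]
        refine mul_le_mul_of_nonneg_left ?_ (hπ.1 y)
        rw [abs_le]
        constructor <;> linarith [key x y, key y x]
    _ = _ := by rw [← Finset.sum_mul, hπ.2, one_mul]

lemma sum_range_mul_le_of_pow {f : ℕ → ℝ} {q : ℝ} (hq0 : 0 ≤ q) (hq1 : q < 1) (s : ℕ)
    (h : ∀ k r, f (k * s + r) ≤ q ^ k) (K : ℕ) :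
    ∑ t ∈ Finset.range (K * s), f t ≤ s / (1 - q) := by
  have key : (∑ t ∈ Finset.range (K * s), f t) * (1 - q) ≤ s * (1 - q ^ K) := by
    induction K with
    | zero => simp
    | succ K ih =>
      have h1 : ∑ r ∈ Finset.range s, f (K * s + r) ≤ s * q ^ K := by
        simpa using Finset.sum_le_card_nsmul (Finset.range s) _ _ fun r _ => h K r
      have h2 := mul_le_mul_of_nonneg_right h1 (sub_nonneg.2 hq1.le)
      rw [Nat.succ_mul, Finset.sum_range_add, add_mul, pow_succ]
      linarith
  rw [le_div_iff₀ (by linarith)]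
  refine key.trans (mul_le_of_le_one_right (Nat.cast_nonneg _) ?_)
  linarith [pow_nonneg hq0 K]

/-- An approximate solution of the Poisson equation for the indicator of a state. -/
lemma exists_approx_poisson {M : Matrix Ω Ω ℝ} (hM : IsStochastic M) (he : IsErgodic M)
    {π : Ω → ℝ} (hπ : IsDist π) (hst : Matrix.vecMul π M = π) (i : Ω) (hi : 0 < π i) :
    ∃ g : Ω → ℝ, (∀ x, |g x| ≤ 2 / (1 - genCC M)) ∧
      ∀ x, g x - (if x = i then 1 else 0) + π i / 2 ≤ M.mulVec g x := by
  have : Nonempty {n : ℕ // 0 < n} := ⟨⟨1, one_pos⟩⟩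
  have hκ : 0 < 1 - genCC M := sub_pos.2 (genCC_lt_one hM he)
  obtain ⟨⟨s, hs⟩, hrate⟩ := exists_lt_of_lt_ciSup (show (1 - genCC M) / 2 <
    ⨆ s : {n : ℕ // 0 < n}, (1 - dobrushin (M ^ (s : ℕ))) / ((s : ℕ) : ℝ) by
      unfold genCC at hκ ⊢; linarith)
  dsimp only at hrate
  have hs' : (0 : ℝ) < s := by exact_mod_cast hs
  set q := dobrushin (M ^ s) with hq
  have hq0 : 0 ≤ q := dobrushin_nonneg_s14 _
  have hq1 : 0 < 1 - q := by
    by_contra hcon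
    have := div_nonpos_of_nonpos_of_nonneg (not_lt.1 hcon) hs'.le
    linarith
  have hsq : s / (1 - q) ≤ 2 / (1 - genCC M) := by
    rw [lt_div_iff₀ hs'] at hrate
    rw [div_le_div_iff₀ hq1 hκ]
    linarith
  have habs := fun k r x => abs_pow_mulVec_sub_le hM hπ hst s k r i x
  obtain ⟨K, hK⟩ := exists_pow_lt_of_lt_one (half_pos hi) (show q < 1 by linarith)
  refine ⟨fun x => ∑ t ∈ Finset.range (K * s), ((M ^ t) x i - π i), fun x => ?_, fun x => ?_⟩
  · refine (Finset.abs_sum_le_sum_abs _ _).trans (le_trans ?_ hsq)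
    exact sum_range_mul_le_of_pow hq0 (by linarith) s (fun k r => habs k r x) K
  · have e : M.mulVec (fun x => ∑ t ∈ Finset.range (K * s), ((M ^ t) x i - π i)) x =
        ∑ t ∈ Finset.range (K * s), ((M ^ (t + 1)) x i - π i) := by
      simp only [Matrix.mulVec, dotProduct, Finset.mul_sum]
      rw [Finset.sum_comm]
      refine Finset.sum_congr rfl fun t _ => ?_
      rw [pow_succ', Matrix.mul_apply]
      simp only [mul_sub, Finset.sum_sub_distrib, ← Finset.sum_mul, hM.2, one_mul]
    have e2 := Finset.sum_range_succ (fun t => (M ^ t) x i - π i) (K * s)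
    rw [Finset.sum_range_succ'] at e2
    have h0 := habs K 0 x
    rw [add_zero, abs_le] at h0
    simp only [pow_zero, Matrix.one_apply] at e2
    rw [e]
    linarith [h0.1]

/-- Number of visits to `i` of the path before its last step. -/
def visits {n : ℕ} (x : Fin (n + 1) → Ω) (i : Ω) : ℝ :=
  ∑ t : Fin n, if x t.castSucc = i then 1 else 0

/-- Number of transitions from `i` to `j` along the path. -/
def transitions {n : ℕ} (x : Fin (n + 1) → Ω) (i j : Ω) : ℝ :=
  ∑ t : Fin n, if x t.castSucc = i ∧ x t.succ = j then 1 else 0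

/-- The empirical transition matrix. -/
noncomputable def empTransition {n : ℕ} (x : Fin (n + 1) → Ω) : Matrix Ω Ω ℝ :=
  Matrix.of fun i j => transitions x i j / visits x i

lemma sum_transitions {n : ℕ} (x : Fin (n + 1) → Ω) (i : Ω) :
    ∑ j, transitions x i j = visits x i := by
  unfold transitions visits
  rw [Finset.sum_comm]
  refine Finset.sum_congr rfl fun t _ => ?_
  by_cases h : x t.castSucc = i <;> simp [h]

lemma empTransition_isStochastic {n : ℕ} {x : Fin (n + 1) → Ω} (h : ∀ i, 0 < visits x i) :
    IsStochastic (empTransition x) := by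
  refine ⟨fun i j => div_nonneg (Finset.sum_nonneg fun t _ => ?_) (h i).le, fun i => ?_⟩
  · split_ifs <;> norm_num
  · simp only [empTransition, Matrix.of_apply, ← Finset.sum_div, sum_transitions]
    exact div_self (h i).ne'

lemma prTraj_visits_le {M : Matrix Ω Ω ℝ} (hM : IsStochastic M) (he : IsErgodic M)
    {μ π : Ω → ℝ} (hμ : IsDist μ) (hπ : IsDist π) (hst : Matrix.vecMul π M = π) (i : Ω)
    (hi : 0 < π i) (n : ℕ) :
    prTraj μ M (n + 1) {x | visits x i ≤ n * π i / 12} ≤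
      3 * Real.exp (-(n * π i * (1 - genCC M) / 24)) := by
  obtain ⟨g, hg, hPg⟩ := exists_approx_poisson hM he hπ hst i hi
  have hκ : 0 < 1 - genCC M := sub_pos.2 (genCC_lt_one hM he)
  set a := (1 - genCC M) / 4 with ha
  have ha0 : 0 < a := by positivity
  have hag : ∀ x, |a * g x| ≤ 1 / 2 := fun x => by
    rw [abs_mul, abs_of_pos ha0]
    calc a * |g x| ≤ a * (2 / (1 - genCC M)) := mul_le_mul_of_nonneg_left (hg x) ha0.le
      _ = 1 / 2 := by rw [ha]; field_simp; norm_num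
  have hφ1 : ∀ x, (1 / 2 : ℝ) ≤ 1 - a * g x := fun x => by linarith [(abs_le.1 (hag x)).2]
  have hφ2 : ∀ x, 1 - a * g x ≤ 3 / 2 := fun x => by linarith [(abs_le.1 (hag x)).1]
  have hmain := prTraj_le_exp hμ hM
    (fun x _ => a * π i / 3 - 2 * a * (if x = i then 1 else 0)) (fun x => 1 - a * g x)
    (l := 1 / 2) (C := 3 / 2) (by norm_num) hφ1 hφ2 (fun x => ?_) (n := n)
    (r := n * π i * (1 - genCC M) / 24) (S := {x | visits x i ≤ n * π i / 12}) (fun x hx => ?_)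
  · norm_num at hmain ⊢
    exact hmain
  · set z : ℝ := if x = i then 1 else 0 with hz
    have hz0 : 0 ≤ z := by rw [hz]; split_ifs <;> norm_num
    have e : ∑ y, M x y * Real.exp (a * π i / 3 - 2 * a * z) * (1 - a * g y) =
        Real.exp (a * π i / 3 - 2 * a * z) * (1 - a * M.mulVec g x) := by
      rw [mul_sub, mul_one, Matrix.mulVec, dotProduct, Finset.mul_sum, Finset.mul_sum]
      simp only [mul_sub, mul_one, Finset.sum_sub_distrib, ← Finset.sum_mul, hM.2]
      rw [one_mul]
      congr 1
      exact Finset.sum_congr rfl fun y _ => by ring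
    rw [e]
    set b := a * π i / 3 - 2 * a * z with hb
    have h1 : 1 - a * M.mulVec g x ≤ (1 - a * g x) * (1 - b) := by
      have := mul_le_mul_of_nonneg_left (hPg x) ha0.le
      have h2 : (1 - a * g x) * (a * π i / 3) ≤ 3 / 2 * (a * π i / 3) :=
        mul_le_mul_of_nonneg_right (hφ2 x) (by positivity)
      have h3 : 1 / 2 * (2 * a * z) ≤ (1 - a * g x) * (2 * a * z) :=
        mul_le_mul_of_nonneg_right (hφ1 x) (by positivity)
      rw [hb]
      linarith
    have h4 : 1 - b ≤ Real.exp (-b) := by linarith [Real.add_one_le_exp (-b)]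
    have h5 : 0 ≤ 1 - a * g x := by linarith [hφ1 x]
    calc _ ≤ Real.exp b * ((1 - a * g x) * Real.exp (-b)) :=
          mul_le_mul_of_nonneg_left (h1.trans (mul_le_mul_of_nonneg_left h4 h5))
            (Real.exp_pos _).le
      _ = 1 - a * g x := by
        rw [mul_left_comm, ← Real.exp_add, add_neg_cancel, Real.exp_zero, mul_one]
  · have hx' : visits x i ≤ n * π i / 12 := hx
    have e : ∑ t : Fin n, (a * π i / 3 - 2 * a * (if x t.castSucc = i then 1 else 0)) =
        n * (a * π i / 3) - 2 * a * visits x i := by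
      rw [Finset.sum_sub_distrib, ← Finset.mul_sum, visits]
      simp
    rw [e]
    have := mul_le_mul_of_nonneg_left hx' ha0.le
    rw [ha] at this ⊢
    linarith

/-- The sign attached to a Boolean. -/
def boolSign (b : Bool) : ℝ := if b then 1 else -1

lemma prTraj_deviation_le {M : Matrix Ω Ω ℝ} (hM : IsStochastic M) {μ : Ω → ℝ}
    (hμ : IsDist μ) (i : Ω) (σ : Ω → Bool) (n : ℕ) {u N : ℝ} (hu0 : 0 < u) (hu1 : u ≤ 1) :
    prTraj μ M (n + 1) {x | N ≤ visits x i ∧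
      u * visits x i ≤ ∑ j, boolSign (σ j) * (transitions x i j - visits x i * M i j)} ≤
      Real.exp (-(u ^ 2 * N / 16)) := by
  have hsig : ∀ j, |boolSign (σ j)| ≤ 1 := fun j => by
    unfold boolSign; split_ifs <;> norm_num
  set p := ∑ j, M i j * boolSign (σ j) with hp
  have hp1 : |p| ≤ 1 := by
    refine (Finset.abs_sum_le_sum_abs _ _).trans ?_
    rw [← hM.2 i]
    refine Finset.sum_le_sum fun j _ => ?_
    rw [abs_mul, abs_of_nonneg (hM.1 i j)]
    exact mul_le_of_le_one_right (hM.1 i j) (hsig j)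
  have hmain := prTraj_le_exp hμ hM
    (fun x y => if x = i then u / 8 * (boolSign (σ y) - p) - u ^ 2 / 16 else 0) (fun _ => 1)
    (l := 1) (C := 1) one_pos (fun _ => le_rfl) (fun _ => le_rfl) (fun x => ?_) (n := n)
    (r := u ^ 2 * N / 16) (S := {x | N ≤ visits x i ∧
      u * visits x i ≤ ∑ j, boolSign (σ j) * (transitions x i j - visits x i * M i j)})
    (fun x hx => ?_)
  · simpa using hmain
  · by_cases hx : x = i
    · subst hx
      simp only [if_true, mul_one, sub_eq_add_neg, Real.exp_add]
      simp only [← sub_eq_add_neg, ← mul_assoc, ← Finset.sum_mul]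
      have hle : ∀ y, M x y * Real.exp (u / 8 * (boolSign (σ y) - p)) ≤
          M x y * (1 + u / 8 * (boolSign (σ y) - p) + u ^ 2 / 16) := fun y => by
        refine mul_le_mul_of_nonneg_left ?_ (hM.1 x y)
        have hd : |boolSign (σ y) - p| ≤ 2 := by
          have := abs_sub (boolSign (σ y)) p
          linarith [hsig y]
        have hz : |u / 8 * (boolSign (σ y) - p)| ≤ u / 4 := by
          rw [abs_mul, abs_of_pos (by positivity : 0 < u / 8)]
          nlinarith
        have h1 := (abs_le.1 (Real.abs_exp_sub_one_sub_id_le (hz.trans (by linarith)))).2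
        have h2 := sq_le_sq' (by linarith [(abs_le.1 hz).1]) (abs_le.1 hz).2
        linarith
      have hsum : ∑ y, M x y * (1 + u / 8 * (boolSign (σ y) - p) + u ^ 2 / 16) =
          1 + u ^ 2 / 16 := by
        have : ∀ y, M x y * (1 + u / 8 * (boolSign (σ y) - p) + u ^ 2 / 16) =
            M x y * (1 - u / 8 * p + u ^ 2 / 16) + u / 8 * (M x y * boolSign (σ y)) :=
          fun y => by ring
        rw [Finset.sum_congr rfl fun y _ => this y, Finset.sum_add_distrib, ← Finset.sum_mul,
          hM.2, ← Finset.mul_sum, ← hp]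
        ring
      calc _ ≤ Real.exp (u ^ 2 / 16) * Real.exp (-(u ^ 2 / 16)) := by
            refine mul_le_mul_of_nonneg_right ?_ (Real.exp_pos _).le
            refine (Finset.sum_le_sum fun y _ => hle y).trans ?_
            rw [hsum, add_comm]
            exact Real.add_one_le_exp _
        _ = 1 := by rw [← Real.exp_add, add_neg_cancel, Real.exp_zero]
    · simp [hx, hM.2]
  · obtain ⟨hN, hdev⟩ := hx
    have e1 : ∑ j, boolSign (σ j) * (transitions x i j - visits x i * M i j) =
        ∑ t : Fin n, if x t.castSucc = i then (boolSign (σ (x t.succ)) - p) else 0 := by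
      have h1 : ∑ j, boolSign (σ j) * (transitions x i j - visits x i * M i j) =
          (∑ j, boolSign (σ j) * transitions x i j) - visits x i * p := by
        rw [hp, Finset.mul_sum, ← Finset.sum_sub_distrib]
        exact Finset.sum_congr rfl fun j _ => by ring
      rw [h1]
      simp only [transitions, visits, Finset.mul_sum, Finset.sum_mul]
      rw [Finset.sum_comm, ← Finset.sum_sub_distrib]
      refine Finset.sum_congr rfl fun t _ => ?_
      by_cases h : x t.castSucc = i <;> simp [h]
    have e2 : ∑ t : Fin n, (if x t.castSucc = i then
        u / 8 * (boolSign (σ (x t.succ)) - p) - u ^ 2 / 16 else 0) =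
        u / 8 * (∑ j, boolSign (σ j) * (transitions x i j - visits x i * M i j)) -
          u ^ 2 / 16 * visits x i := by
      rw [e1, visits, Finset.mul_sum, Finset.mul_sum, ← Finset.sum_sub_distrib]
      refine Finset.sum_congr rfl fun t _ => ?_
      split_ifs <;> ring
    rw [e2]
    have h1 := mul_le_mul_of_nonneg_left hdev (by positivity : 0 ≤ u / 8)
    have h2 := mul_le_mul_of_nonneg_left hN (by positivity : 0 ≤ u ^ 2 / 16)
    linarith

lemma exists_boolSign_mul_eq_abs (v : Ω → ℝ) : ∃ σ : Ω → Bool, ∀ j, boolSign (σ j) * v j = |v j| := by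
  refine ⟨fun j => decide (0 ≤ v j), fun j => ?_⟩
  by_cases h : 0 ≤ v j
  · simp [boolSign, h, abs_of_nonneg h]
  · simp [boolSign, h, abs_of_neg (not_le.1 h)]

lemma sum_abs_empTransition_sub_le {n : ℕ} {x : Fin (n + 1) → Ω} {M : Matrix Ω Ω ℝ} {i : Ω}
    {u : ℝ} (hi : 0 < visits x i)
    (h : ∀ σ : Ω → Bool,
      ∑ j, boolSign (σ j) * (transitions x i j - visits x i * M i j) ≤ u * visits x i) :
    ∑ j, |empTransition x i j - M i j| ≤ u := by
  obtain ⟨σ, hσ⟩ := exists_boolSign_mul_eq_abs fun j => transitions x i j - visits x i * M i j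
  have e : ∀ j, |empTransition x i j - M i j| =
      |transitions x i j - visits x i * M i j| / visits x i := fun j => by
    rw [empTransition, Matrix.of_apply, div_sub' hi.ne', abs_div, abs_of_pos hi]
  simp only [e, ← Finset.sum_div]
  rw [div_le_iff₀ hi]
  simpa only [hσ] using h σ

/-- Failure probability of the plug-in estimate of the generalized contraction coefficient. -/
lemma one_sub_le_prTraj_abs_genCC_empTransition_sub_le {M : Matrix Ω Ω ℝ} (hM : IsStochastic M)
    (he : IsErgodic M) {μ π : Ω → ℝ} (hμ : IsDist μ) (hπ : IsDist π)
    (hst : Matrix.vecMul π M = π) {η : ℝ} (hη0 : 0 < η) (hη : ∀ i, η ≤ π i) (n : ℕ) {u : ℝ}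
    (hu0 : 0 < u) (hu1 : u ≤ 1) :
    1 - (Fintype.card Ω * (3 * Real.exp (-(n * η * (1 - genCC M) / 24))) +
      Fintype.card Ω * 2 ^ Fintype.card Ω * Real.exp (-(u ^ 2 * (n * η / 12) / 16))) ≤
    prTraj μ M (n + 1) {x | |genCC (empTransition x) - genCC M| ≤ u} := by
  have hκ : 0 < 1 - genCC M := sub_pos.2 (genCC_lt_one hM he)
  have hU := one_le_prTraj_add_sum hμ hM (m := n + 1) (ι := Ω ⊕ Ω × (Ω → Bool))
    {x | |genCC (empTransition x) - genCC M| ≤ u}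
    (Sum.elim (fun i => {x | visits x i ≤ n * π i / 12}) fun k =>
      {x | n * η / 12 ≤ visits x k.1 ∧ u * visits x k.1 ≤
        ∑ j, boolSign (k.2 j) * (transitions x k.1 j - visits x k.1 * M k.1 j)}) (fun x hx => ?_)
  · rw [Fintype.sum_sum_type] at hU
    simp only [Sum.elim_inl, Sum.elim_inr] at hU
    have h1 : ∑ i, prTraj μ M (n + 1) {x | visits x i ≤ n * π i / 12} ≤
        Fintype.card Ω * (3 * Real.exp (-(n * η * (1 - genCC M) / 24))) := by
      rw [← nsmul_eq_mul]
      refine Finset.sum_le_card_nsmul _ _ _ fun i _ => ?_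
      refine (prTraj_visits_le hM he hμ hπ hst i (hη0.trans_le (hη i)) n).trans ?_
      have := hη i
      gcongr
    have h2 := Finset.sum_le_card_nsmul Finset.univ
      (fun k : Ω × (Ω → Bool) => prTraj μ M (n + 1) {x | n * η / 12 ≤ visits x k.1 ∧
        u * visits x k.1 ≤
          ∑ j, boolSign (k.2 j) * (transitions x k.1 j - visits x k.1 * M k.1 j)})
      _ fun k _ => prTraj_deviation_le hM hμ k.1 k.2 n hu0 hu1
    simp only [Finset.card_univ, Fintype.card_prod, Fintype.card_fun, Fintype.card_bool,
      nsmul_eq_mul, Nat.cast_mul, Nat.cast_pow, Nat.cast_ofNat] at h2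
    linarith
  · by_contra! hcon
    have hv : ∀ i, n * π i / 12 < visits x i := fun i => not_le.1 (hcon (Sum.inl i))
    have hv0 : ∀ i, 0 < visits x i := fun i =>
      lt_of_le_of_lt (by have := hπ.1 i; positivity) (hv i)
    refine hx (abs_genCC_sub_le (empTransition_isStochastic hv0) hM fun i =>
      sum_abs_empTransition_sub_le (hv0 i) fun σ => ?_)
    by_contra! hσ
    refine hcon (Sum.inr (i, σ)) ⟨le_trans ?_ (hv i).le, hσ.le⟩
    have := hη i
    gcongr

lemma prTraj_mono {μ : Ω → ℝ} {M : Matrix Ω Ω ℝ} (hμ : IsDist μ) (hM : IsStochastic M) {m : ℕ}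
    {A B : Set (Fin m → Ω)} (h : A ⊆ B) : prTraj μ M m A ≤ prTraj μ M m B :=
  Finset.sum_le_sum fun x _ =>
    Set.indicator_le_indicator_of_subset h (fun y => pathProb_nonneg hμ hM y) x

/-- Truncation of a real number to `[ε / 4, 1 - ε / 4]`. -/
noncomputable def truncate (ε a : ℝ) : ℝ := max (ε / 4) (min a (1 - ε / 4))

lemma truncate_mem_Ioo {ε : ℝ} (hε : ε ∈ Set.Ioo (0 : ℝ) 1) (a : ℝ) :
    truncate ε a ∈ Set.Ioo (0 : ℝ) 1 := by
  obtain ⟨h0, h1⟩ := hε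
  refine ⟨lt_max_of_lt_left (by linarith), max_lt (by linarith) (min_lt_of_right_lt (by linarith))⟩

lemma abs_truncate_sub_lt {ε a b : ℝ} (hε : ε ∈ Set.Ioo (0 : ℝ) 1) (hb0 : 0 ≤ b) (hb1 : b ≤ 1)
    (h : |a - b| ≤ ε / 2) : |truncate ε a - b| < ε := by
  obtain ⟨h0, h1⟩ := hε
  rw [abs_le] at h
  rw [abs_lt]
  unfold truncate
  rcases le_total a (1 - ε / 4) with h3 | h3 <;>
  [rw [min_eq_left h3]; rw [min_eq_right h3]] <;>
  [rcases le_total (ε / 4) a with h4 | h4; rcases le_total (ε / 4) (1 - ε / 4) with h4 | h4] <;>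
  [rw [max_eq_right h4]; rw [max_eq_left h4]; rw [max_eq_right h4]; rw [max_eq_left h4]] <;>
  constructor <;> linarith [h.1, h.2]

lemma piMinOf_le (π : Ω → ℝ) (i : Ω) : piMinOf π ≤ π i :=
  Finset.inf'_le π (Finset.mem_univ i)

lemma piMinOf_pos {M : Matrix Ω Ω ℝ} (he : IsErgodic M) {π : Ω → ℝ} (hπ : IsDist π)
    (hst : Matrix.vecMul π M = π) : 0 < piMinOf π := by
  obtain ⟨p, -, hp⟩ := he
  refine (Finset.lt_inf'_iff _).2 fun i _ => ?_
  have e : π i = ∑ j, π j * (M ^ p) j i := by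
    conv_lhs => rw [← vecMul_pow_of_stationary hst p]
    rfl
  rw [e]
  obtain ⟨j, -, hj⟩ : ∃ j ∈ Finset.univ, 0 < π j :=
    Finset.exists_lt_of_sum_lt (f := fun _ => (0 : ℝ)) (by simp [hπ.2])
  exact Finset.sum_pos' (fun k _ => mul_nonneg (hπ.1 k) (hp k i).le)
    ⟨j, Finset.mem_univ j, mul_pos hj (hp j i)⟩

lemma card_mul_piMinOf_le {π : Ω → ℝ} (hπ : IsDist π) : Fintype.card Ω * piMinOf π ≤ 1 := by
  rw [← hπ.2, ← nsmul_eq_mul]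
  exact Finset.card_nsmul_le_sum _ _ _ fun i _ => piMinOf_le π i

/-- The sample size requirement forces a nonempty trajectory and a failure probability at
most `δ`. -/
lemma failure_le_of_sample_size {ε δ η γ : ℝ} {d m : ℕ} (hε : ε ∈ Set.Ioo (0 : ℝ) 1)
    (hδ : δ ∈ Set.Ioo (0 : ℝ) 1) (hd : 2 ≤ d) (hη : 0 < η) (hdη : d * η ≤ 1) (hγ : 0 < γ)
    (h : (m : ℝ) ≥ 20000 * (1 * Real.log ((d : ℝ) / (δ * ε * η)) *
      Real.log (Real.log ((d : ℝ) / (δ * ε * η)))) / η * max (1 / γ) ((d : ℝ) / ε ^ 2)) :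
    0 < m ∧ (d : ℝ) * (3 * Real.exp (-((m - 1) * η * γ / 24))) +
      d * 2 ^ d * Real.exp (-((ε / 2) ^ 2 * ((m - 1) * η / 12) / 16)) ≤ δ := by
  obtain ⟨hε0, hε1⟩ := hε
  obtain ⟨hδ0, hδ1⟩ := hδ
  have hd' : (2 : ℝ) ≤ d := by exact_mod_cast hd
  set X := (d : ℝ) / (δ * ε * η) with hX
  set L := Real.log X with hL
  set Q := max (1 / γ) ((d : ℝ) / ε ^ 2) with hQ
  have hη1 : η ≤ 1 / 2 := by nlinarith
  have hXd : 2 * d / δ ≤ X := by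
    rw [hX, div_le_div_iff₀ hδ0 (by positivity)]
    have h1 : ε * η ≤ 1 / 2 := by nlinarith
    have h2 : (d * δ) * (ε * η) ≤ (d * δ) * (1 / 2) :=
      mul_le_mul_of_nonneg_left h1 (by positivity)
    linarith
  have hX4 : 4 ≤ X := by
    refine le_trans ?_ hXd
    rw [le_div_iff₀ hδ0]
    linarith
  have hX0 : 0 < X := by linarith
  have hL1 : 1.38 ≤ L := by
    have h1 : Real.log 4 ≤ L := Real.log_le_log (by norm_num) hX4
    have h2 : Real.log 4 = 2 * Real.log 2 := by
      rw [show (4 : ℝ) = 2 ^ 2 by norm_num, Real.log_pow]; norm_num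
    linarith [Real.log_two_gt_d9]
  have hLL : 1 / 4 ≤ Real.log L := by
    have h1 := Real.one_sub_inv_le_log_of_pos (show 0 < L by linarith)
    have h2 : L⁻¹ ≤ 1.38⁻¹ := inv_anti₀ (by norm_num) hL1
    norm_num at h1 h2
    linarith
  have hQd : d / ε ^ 2 ≤ Q := le_max_right _ _
  have hQγ : 1 / γ ≤ Q := le_max_left _ _
  have hQ2 : 2 ≤ Q := by
    refine le_trans ?_ hQd
    rw [le_div_iff₀ (by positivity)]
    nlinarith
  have hm : 5000 * L * Q ≤ m * η := by
    have h1 : 20000 * (1 * L * (1 / 4)) / η * Q ≤ (m : ℝ) := by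
      refine le_trans ?_ h
      gcongr
    rw [div_mul_eq_mul_div, div_le_iff₀ hη] at h1
    linarith
  have hLQ : 1 ≤ L * Q := by nlinarith
  have hm0 : 0 < m := by
    rcases Nat.eq_zero_or_pos m with rfl | hpos
    · rw [Nat.cast_zero, zero_mul] at hm
      linarith
    · exact hpos
  refine ⟨hm0, ?_⟩
  set n : ℝ := m - 1 with hn_def
  have hn : 2500 * L * Q ≤ n * η := by nlinarith
  have hexpL : Real.exp L = X := Real.exp_log hX0
  have hE1 : 3 * L ≤ n * η * γ / 24 := by
    have h1 : 1 ≤ Q * γ := by rwa [div_le_iff₀ hγ] at hQγ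
    have h2 := mul_le_mul_of_nonneg_right hn hγ.le
    have h3 := mul_le_mul_of_nonneg_left h1 (by linarith : 0 ≤ L)
    nlinarith
  have hE2 : L + d * L ≤ (ε / 2) ^ 2 * (n * η / 12) / 16 := by
    have h1 : (d : ℝ) ≤ Q * ε ^ 2 := by rwa [div_le_iff₀ (by positivity)] at hQd
    have h2 := mul_le_mul_of_nonneg_right hn (sq_nonneg ε)
    have h3 := mul_le_mul_of_nonneg_left h1 (by linarith : 0 ≤ L)
    nlinarith
  have hP1 : d * (3 * Real.exp (-(n * η * γ / 24))) ≤ δ / 2 := by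
    have h1 : 6 * d / δ ≤ Real.exp (n * η * γ / 24) := by
      refine le_trans ?_ (Real.exp_le_exp.2 hE1)
      have h2 : Real.exp (3 * L) = X ^ 2 * X := by
        rw [← hexpL, ← Real.exp_nat_mul, ← Real.exp_add]; congr 1; push_cast; ring
      rw [h2]
      calc 6 * d / δ = 3 * (2 * d / δ) := by ring
        _ ≤ X ^ 2 * X := mul_le_mul (by nlinarith) hXd (by positivity) (by positivity)
    rw [div_le_iff₀ hδ0] at h1
    rw [Real.exp_neg, ← mul_assoc, ← div_eq_mul_inv, div_le_iff₀ (Real.exp_pos _)]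
    linarith
  have hP2 : d * 2 ^ d * Real.exp (-((ε / 2) ^ 2 * (n * η / 12) / 16)) ≤ δ / 2 := by
    have h1 : 2 * d / δ * 2 ^ d ≤ Real.exp ((ε / 2) ^ 2 * (n * η / 12) / 16) := by
      refine le_trans ?_ (Real.exp_le_exp.2 hE2)
      rw [Real.exp_add, Real.exp_nat_mul, hexpL]
      gcongr
      linarith
    rw [div_mul_eq_mul_div, div_le_iff₀ hδ0] at h1
    rw [Real.exp_neg, ← div_eq_mul_inv, div_le_iff₀ (Real.exp_pos _)]
    linarith
  linarith

/-- point estimator for `κ̃` with absolute error `ε`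
(Theorem 3 of the paper). -/
theorem point_estimator_absolute :
    ∃ c : ℝ, 0 < c ∧ ∃ c' : ℝ, 0 < c' ∧
      ∀ (ε δ : ℝ), ε ∈ Set.Ioo (0 : ℝ) 1 → δ ∈ Set.Ioo (0 : ℝ) 1 →
      ∀ (d : ℕ) (Ω : Type) [Fintype Ω] [DecidableEq Ω] [Nonempty Ω],
        Fintype.card Ω = d →
        ∀ m : ℕ, ∃ κhat : (Fin m → Ω) → ℝ,
          (∀ x, κhat x ∈ Set.Ioo (0 : ℝ) 1) ∧
          ∀ (M : Matrix Ω Ω ℝ) (μ π : Ω → ℝ),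
            IsStochastic M → IsErgodic M → IsDist μ → IsDist π →
            Matrix.vecMul π M = π →
            (m : ℝ) ≥ c * (c' * Real.log ((d : ℝ) / (δ * ε * piMinOf π)) *
                Real.log (Real.log ((d : ℝ) / (δ * ε * piMinOf π)))) / piMinOf π *
                max (1 / (1 - genCC M)) ((d : ℝ) / ε ^ 2) →
            1 - δ ≤ prTraj μ M m {x | |κhat x - genCC M| < ε} := by
  refine ⟨20000, by norm_num, 1, one_pos, fun ε δ hε hδ d Ω _ _ _ hd m => ?_⟩
  have hconst := truncate_mem_Ioo hε 0
  rcases Nat.lt_or_ge d 2 with hd1 | hd2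
  · have : Subsingleton Ω := Fintype.card_le_one_iff_subsingleton.1 (by omega)
    refine ⟨fun _ => truncate ε 0, fun _ => hconst, fun M μ π hM _ hμ _ _ _ => ?_⟩
    have hE : {x : Fin m → Ω | |truncate ε 0 - genCC M| < ε} = Set.univ :=
      Set.eq_univ_of_forall fun _ => abs_truncate_sub_lt hε (genCC_nonneg M)
        (by rw [genCC_of_subsingleton]; norm_num)
        (by rw [genCC_of_subsingleton, sub_zero, abs_zero]; linarith [hε.1])
    rw [hE, prTraj, Set.indicator_univ, sum_pathProb hμ hM]
    linarith [hδ.1]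
  cases m with
  | zero =>
    refine ⟨fun _ => truncate ε 0, fun _ => hconst, fun M μ π hM he hμ hπ hst hm => ?_⟩
    exact absurd (failure_le_of_sample_size hε hδ hd2 (piMinOf_pos he hπ hst)
      (hd ▸ card_mul_piMinOf_le hπ) (sub_pos.2 (genCC_lt_one hM he)) hm).1 (lt_irrefl 0)
  | succ n =>
    refine ⟨fun x => truncate ε (genCC (empTransition x)), fun x => truncate_mem_Ioo hε _,
      fun M μ π hM he hμ hπ hst hm => ?_⟩
    have hcard := card_mul_piMinOf_le hπ
    have hη := piMinOf_pos he hπ hst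
    have hκ := genCC_lt_one hM he
    have hmain := one_sub_le_prTraj_abs_genCC_empTransition_sub_le hM he hμ hπ hst hη
      (piMinOf_le π) n (u := ε / 2) (by linarith [hε.1]) (by linarith [hε.2])
    rw [hd] at hcard hmain
    have hfail := (failure_le_of_sample_size hε hδ hd2 hη hcard (sub_pos.2 hκ) hm).2
    rw [Nat.cast_succ, add_sub_cancel_right] at hfail
    refine le_trans (by linarith) (hmain.trans (prTraj_mono hμ hM fun x hx => ?_))
    exact abs_truncate_sub_lt hε (genCC_nonneg M) hκ.le hx
end
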